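/- Let N ∈ ℕ, 1 < p < ∞, and −N < α < N(p−1). Define the weight w on ℝ^N by w(x) = |x|^α for |x| ≤ 1 and w(x) = exp(|x| − 1) for |x| > 1 (with |x| the Euclidean norm). Then A_p^loc(w) < ∞, while A_q(w) = ∞ for every q ∈ (1, ∞); in particular w belongs to A_p^loc but does not belong to A_∞ = ∪_{q≥1} A_q. -/

import Mathlib

open MeasureTheory ENNReal

/-- The axis-parallel cube in `ℝ^N` with lower corner `a` and side length `l`. -/
def cube (N : ℕ) (a : Fin N → ℝ) (l : ℝ) : Set (Fin N → ℝ) :=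
  Set.univ.pi fun i => Set.Ico (a i) (a i + l)

/-- A weight on `ℝ^N`: a locally integrable function, positive almost everywhere. -/
def IsWeight {N : ℕ} (w : (Fin N → ℝ) → ℝ) : Prop :=
  LocallyIntegrable w volume ∧ ∀ᵐ x : Fin N → ℝ, 0 < w x

/-- The Muckenhoupt expression `(|Q|⁻¹∫_Q w) (|Q|⁻¹∫_Q w^{1-p'})^{p-1}` for the cube
with corner `a` and side `l`, where `p' = p/(p-1)`. -/
noncomputable def apFactor (N : ℕ) (p : ℝ) (w : (Fin N → ℝ) → ℝ)
    (a : Fin N → ℝ) (l : ℝ) : ℝ≥0∞ :=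
  ((∫⁻ x in cube N a l, ENNReal.ofReal (w x)) / ENNReal.ofReal (l ^ N)) *
    (((∫⁻ x in cube N a l, ENNReal.ofReal (w x) ^ (1 - p / (p - 1))) /
        ENNReal.ofReal (l ^ N)) ^ (p - 1))

/-- The Muckenhoupt constant `A_p(w)`: supremum over all axis-parallel cubes. -/
noncomputable def apConst (N : ℕ) (p : ℝ) (w : (Fin N → ℝ) → ℝ) : ℝ≥0∞ :=
  ⨆ (a : Fin N → ℝ) (l : ℝ) (_ : 0 < l), apFactor N p w a l

/-- The local Muckenhoupt constant `A_p^loc(w)`: supremum over cubes of volume `≤ 1`. -/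
noncomputable def apLocConst (N : ℕ) (p : ℝ) (w : (Fin N → ℝ) → ℝ) : ℝ≥0∞ :=
  ⨆ (a : Fin N → ℝ) (l : ℝ) (_ : 0 < l) (_ : l ^ N ≤ 1), apFactor N p w a l

/-- The Euclidean norm on `ℝ^N`. -/
noncomputable def euclNorm {N : ℕ} (x : Fin N → ℝ) : ℝ :=
  Real.sqrt (∑ i, (x i) ^ 2)

open Set Filter Topology

lemma volume_cube {N : ℕ} (a : Fin N → ℝ) {l : ℝ} (hl : 0 < l) :
    volume (cube N a l) = ENNReal.ofReal (l ^ N) := by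
  rw [cube, Real.volume_pi_Ico]
  simp [ENNReal.ofReal_pow hl.le]

lemma measurableSet_cube {N : ℕ} (a : Fin N → ℝ) (l : ℝ) : MeasurableSet (cube N a l) :=
  MeasurableSet.univ_pi fun _ => measurableSet_Ico

lemma norm_sub_lt_of_mem_cube {N : ℕ} {a x y : Fin N → ℝ} {l : ℝ} (hl : 0 < l)
    (hx : x ∈ cube N a l) (hy : y ∈ cube N a l) : ‖x - y‖ < l := by
  rw [pi_norm_lt_iff hl]
  intro i
  have h1 := hx i (mem_univ i)
  have h2 := hy i (mem_univ i)
  simp only [mem_Ico] at h1 h2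
  rw [Pi.sub_apply, Real.norm_eq_abs, abs_lt]
  constructor <;> linarith

/-- If `u` and `v` agree on a cube up to a multiplicative constant and an oscillation factor `C`,
then their Muckenhoupt expressions differ by at most the factor `C`. -/
lemma apFactor_le_of_comparable {N : ℕ} {p c C l : ℝ} (hp : 1 < p) (hc : 0 < c) (hC : 0 ≤ C)
    {u v : (Fin N → ℝ) → ℝ} (a : Fin N → ℝ)
    (h : ∀ x ∈ cube N a l, c * v x ≤ u x ∧ u x ≤ C * c * v x) :
    apFactor N p u a l ≤ ENNReal.ofReal C * apFactor N p v a l := by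
  have hp1 : 0 < p - 1 := by linarith
  set s : ℝ := 1 - p / (p - 1) with hs
  have hs' : s = -(1 / (p - 1)) := by rw [hs]; field_simp; ring
  have hs0 : 0 ≤ -s := by rw [hs']; simp only [neg_neg]; positivity
  have hsp : s * (p - 1) = -1 := by rw [hs']; field_simp
  have hc0 : ENNReal.ofReal c ≠ 0 := by simpa using hc
  have h1 : ∫⁻ x in cube N a l, ENNReal.ofReal (u x) ≤
      ENNReal.ofReal (C * c) * ∫⁻ x in cube N a l, ENNReal.ofReal (v x) := by
    rw [← lintegral_const_mul' _ _ ofReal_ne_top]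
    refine setLIntegral_mono' (measurableSet_cube a l) fun x hx => ?_
    rw [← ENNReal.ofReal_mul (by positivity)]
    exact ENNReal.ofReal_le_ofReal (h x hx).2
  have h2 : ∫⁻ x in cube N a l, ENNReal.ofReal (u x) ^ s ≤
      ENNReal.ofReal c ^ s * ∫⁻ x in cube N a l, ENNReal.ofReal (v x) ^ s := by
    rw [← lintegral_const_mul' _ _ (ENNReal.rpow_ne_top_of_ne_zero hc0 ofReal_ne_top)]
    refine setLIntegral_mono' (measurableSet_cube a l) fun x hx => ?_
    rw [← ENNReal.mul_rpow_of_ne_top ofReal_ne_top ofReal_ne_top,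
      ← ENNReal.ofReal_mul hc.le]
    nth_rewrite 1 [← neg_neg s]
    nth_rewrite 2 [← neg_neg s]
    rw [ENNReal.rpow_neg, ENNReal.rpow_neg _ (-s)]
    exact ENNReal.inv_le_inv.2
      (ENNReal.rpow_le_rpow (ENNReal.ofReal_le_ofReal (h x hx).1) hs0)
  have h3 : (ENNReal.ofReal c ^ s) ^ (p - 1) = (ENNReal.ofReal c)⁻¹ := by
    rw [← ENNReal.rpow_mul, hsp, ENNReal.rpow_neg_one]
  unfold apFactor
  calc _ ≤ (ENNReal.ofReal (C * c) * (∫⁻ x in cube N a l, ENNReal.ofReal (v x)) /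
          ENNReal.ofReal (l ^ N)) *
        ((ENNReal.ofReal c ^ s * (∫⁻ x in cube N a l, ENNReal.ofReal (v x) ^ s) /
          ENNReal.ofReal (l ^ N)) ^ (p - 1)) := by gcongr
    _ = _ := by
      rw [mul_div_assoc, mul_div_assoc, ENNReal.mul_rpow_of_nonneg _ _ hp1.le, h3,
        ENNReal.ofReal_mul hC]
      rw [show ∀ A B X Y D : ℝ≥0∞, A * B * X * (D * Y) = (B * D) * (A * (X * Y)) by
        intros; ring, ENNReal.mul_inv_cancel hc0 ofReal_ne_top, one_mul]

lemma apFactor_one {N : ℕ} (p : ℝ) (a : Fin N → ℝ) {l : ℝ} (hl : 0 < l) :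
    apFactor N p (fun _ => 1) a l = 1 := by
  have h : ENNReal.ofReal (l ^ N) ≠ 0 := by simpa using pow_pos hl N
  simp [apFactor, volume_cube a hl, ENNReal.div_self h]

lemma rpow_le_of_comparable {s t k : ℝ} (α : ℝ) (hs : 0 < s) (ht : 0 < t) (hk : 1 ≤ k)
    (h1 : s ≤ k * t) (h2 : t ≤ k * s) : s ^ α ≤ k ^ |α| * t ^ α := by
  have hk0 : 0 < k := by linarith
  rcases le_total 0 α with h | h
  · rw [abs_of_nonneg h, ← Real.mul_rpow hk0.le ht.le]
    exact Real.rpow_le_rpow hs.le h1 h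
  · rw [abs_of_nonpos h]
    have := Real.rpow_le_rpow_of_nonpos ht h2 h
    rw [Real.mul_rpow hk0.le hs.le] at this
    rw [Real.rpow_neg hk0.le]
    have hk' : 0 < k ^ α := Real.rpow_pos_of_pos hk0 α
    rw [inv_mul_eq_div, le_div_iff₀ hk']
    linarith

lemma lintegral_ball_norm_rpow {N : ℕ} (hN : 0 < N) {β : ℝ} (hβ : -(N : ℝ) < β) :
    ∃ C : ℝ, 0 ≤ C ∧ ∀ R : ℝ, 0 < R →
      ∫⁻ x in Metric.ball (0 : Fin N → ℝ) R, ENNReal.ofReal (‖x‖ ^ β) ≤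
        ENNReal.ofReal (C * R ^ (N + β)) := by
  have : Nonempty (Fin N) := ⟨⟨0, hN⟩⟩
  have hNβ : 0 < N + β := by linarith
  have hexp : -1 < (N : ℝ) + β - 1 := by linarith
  have hpow : ∀ y : ℝ, 0 < y → y ^ (N - 1) • y ^ β = y ^ ((N : ℝ) + β - 1) := by
    intro y hy
    rw [smul_eq_mul, ← Real.rpow_natCast, ← Real.rpow_add hy, Nat.cast_sub hN]
    congr 1
    push_cast
    ring
  refine ⟨N * volume.real (Metric.ball (0 : Fin N → ℝ) 1) / (N + β), by positivity, ?_⟩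
  intro R hR
  have hint : IntegrableOn (fun x : Fin N → ℝ => ‖x‖ ^ β) (Metric.ball 0 R) volume := by
    rw [integrableOn_fun_norm_addHaar volume (f := fun t => t ^ β), Module.finrank_fin_fun,
      integrableOn_congr_fun (fun y hy => hpow y hy.1) measurableSet_Ioo,
      ← integrableOn_Ioc_iff_integrableOn_Ioo,
      ← intervalIntegrable_iff_integrableOn_Ioc_of_le hR.le]
    exact intervalIntegral.intervalIntegrable_rpow' hexp
  rw [← ofReal_integral_eq_lintegral_ofReal hint
    (ae_of_all _ fun x => Real.rpow_nonneg (norm_nonneg x) β)]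
  refine ENNReal.ofReal_le_ofReal (le_of_eq ?_)
  rw [← integral_indicator measurableSet_ball]
  have : (Metric.ball (0 : Fin N → ℝ) R).indicator (fun x => ‖x‖ ^ β) =
      fun x => (Iio R).indicator (fun t => t ^ β) ‖x‖ := by
    ext x
    simp [indicator]
  have h2 : ∫ y in Ioi (0 : ℝ), y ^ (N - 1) • (Iio R).indicator (fun t => t ^ β) y =
      R ^ ((N : ℝ) + β) / (N + β) := by
    have : ∀ y ∈ Ioi (0 : ℝ), y ^ (N - 1) • (Iio R).indicator (fun t => t ^ β) y =
        (Iio R).indicator (fun t => t ^ ((N : ℝ) + β - 1)) y := by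
      intro y hy
      by_cases h : y < R
      · simpa [indicator, h] using hpow y hy
      · simp [indicator, h]
    rw [setIntegral_congr_fun measurableSet_Ioi this, setIntegral_indicator measurableSet_Iio,
      Ioi_inter_Iio, ← integral_Ioc_eq_integral_Ioo, ← intervalIntegral.integral_of_le hR.le,
      integral_rpow (Or.inl hexp)]
    simp [Real.zero_rpow hNβ.ne']
  rw [this, integral_fun_norm_addHaar, Module.finrank_fin_fun, h2]
  simp only [nsmul_eq_mul, smul_eq_mul]
  ring

/-- Uniform bound of the Muckenhoupt expression of `‖x‖ ^ α` over all cubes. -/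
lemma exists_apFactor_norm_rpow_le {N : ℕ} (hN : 0 < N) {p α : ℝ} (hp : 1 < p)
    (hα : -(N : ℝ) < α) (hα' : α < N * (p - 1)) :
    ∃ C : ℝ, ∀ (a : Fin N → ℝ) (l : ℝ), 0 < l →
      apFactor N p (fun x => ‖x‖ ^ α) a l ≤ ENNReal.ofReal C := by
  have : Nonempty (Fin N) := ⟨⟨0, hN⟩⟩
  have hp1 : 0 < p - 1 := by linarith
  set s : ℝ := 1 - p / (p - 1) with hs
  have hs' : s = -(1 / (p - 1)) := by rw [hs]; field_simp; ring
  have hsp : s * (p - 1) = -1 := by rw [hs']; field_simp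
  have hαs : -(N : ℝ) < α * s := by
    rw [hs', mul_neg, neg_lt_neg_iff, mul_one_div, div_lt_iff₀ hp1]
    exact hα'
  obtain ⟨A, hA, hA'⟩ := lintegral_ball_norm_rpow hN hα
  obtain ⟨B, hB, hB'⟩ := lintegral_ball_norm_rpow hN hαs
  refine ⟨max (4 ^ |α|) (A * 2 ^ (N + α) * (B * 2 ^ (N + α * s)) ^ (p - 1)), ?_⟩
  intro a l hl
  by_cases hfar : ∀ x ∈ cube N a l, l ≤ ‖x‖
  · refine le_trans ?_ (ENNReal.ofReal_le_ofReal (le_max_left _ _))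
    have ha : a ∈ cube N a l := fun i _ => ⟨le_rfl, by linarith⟩
    have ha0 : 0 < ‖a‖ := hl.trans_le (hfar a ha)
    have h2 : (0 : ℝ) < 2 ^ |α| := by positivity
    have key := apFactor_le_of_comparable (u := fun x => ‖x‖ ^ α) (v := fun _ => 1) (l := l)
      (c := (2 ^ |α|)⁻¹ * ‖a‖ ^ α) (C := 4 ^ |α|) hp (by positivity) (by positivity) a ?_
    · rwa [apFactor_one p a hl, mul_one] at key
    intro x hx
    have hx0 : 0 < ‖x‖ := hl.trans_le (hfar x hx)
    have h3 : ‖x‖ ≤ 2 * ‖a‖ := by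
      have := norm_sub_lt_of_mem_cube hl hx ha
      have := norm_sub_norm_le x a
      linarith [hfar a ha]
    have h4 : ‖a‖ ≤ 2 * ‖x‖ := by
      have := norm_sub_lt_of_mem_cube hl ha hx
      have := norm_sub_norm_le a x
      linarith [hfar x hx]
    constructor
    · rw [mul_one, inv_mul_le_iff₀ h2]
      exact rpow_le_of_comparable α ha0 hx0 one_le_two h4 h3
    · have h44 : (4 : ℝ) ^ |α| = 2 ^ |α| * 2 ^ |α| := by
        rw [← Real.mul_rpow (by norm_num) (by norm_num)]; norm_num
      rw [h44, mul_one, mul_assoc, mul_inv_cancel_left₀ h2.ne']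
      exact rpow_le_of_comparable α hx0 ha0 one_le_two h3 h4
  · push Not at hfar
    obtain ⟨y, hy, hyl⟩ := hfar
    refine le_trans ?_ (ENNReal.ofReal_le_ofReal (le_max_right _ _))
    have hsub : cube N a l ⊆ Metric.ball 0 (2 * l) := by
      intro x hx
      have := norm_sub_lt_of_mem_cube hl hx hy
      have := norm_sub_norm_le x y
      rw [mem_ball_zero_iff]
      linarith
    have hlN : 0 < l ^ N := pow_pos hl N
    have avg : ∀ (β D : ℝ), (∀ R : ℝ, 0 < R →
        ∫⁻ x in Metric.ball (0 : Fin N → ℝ) R, ENNReal.ofReal (‖x‖ ^ β) ≤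
        ENNReal.ofReal (D * R ^ (N + β))) →
        (∫⁻ x in cube N a l, ENNReal.ofReal (‖x‖ ^ β)) / ENNReal.ofReal (l ^ N) ≤
        ENNReal.ofReal (D * 2 ^ (N + β) * l ^ β) := by
      intro β D hD
      rw [ENNReal.div_le_iff (by simpa using hlN) ofReal_ne_top]
      refine (lintegral_mono_set hsub).trans ((hD _ (by positivity)).trans ?_)
      rw [← ENNReal.ofReal_mul' hlN.le]
      refine ENNReal.ofReal_le_ofReal (le_of_eq ?_)
      rw [Real.mul_rpow (by norm_num) hl.le, Real.rpow_add hl, Real.rpow_natCast]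
      ring
    have hae : ∫⁻ x in cube N a l, ENNReal.ofReal (‖x‖ ^ α) ^ s =
        ∫⁻ x in cube N a l, ENNReal.ofReal (‖x‖ ^ (α * s)) := by
      refine lintegral_congr_ae (ae_restrict_of_ae ?_)
      filter_upwards [compl_mem_ae_iff.2 (measure_singleton (μ := volume) (0 : Fin N → ℝ))]
        with x hx
      have hx0 : 0 < ‖x‖ := norm_pos_iff.2 hx
      rw [ENNReal.ofReal_rpow_of_pos (by positivity), Real.rpow_mul hx0.le]
    unfold apFactor
    rw [← hs, hae]
    calc _ ≤ ENNReal.ofReal (A * 2 ^ (N + α) * l ^ α) *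
          ENNReal.ofReal (B * 2 ^ (N + α * s) * l ^ (α * s)) ^ (p - 1) := by
          gcongr
          · exact avg α A hA'
          · exact avg (α * s) B hB'
      _ = _ := by
        rw [ENNReal.ofReal_rpow_of_nonneg (by positivity) hp1.le,
          ← ENNReal.ofReal_mul (by positivity),
          Real.mul_rpow (z := p - 1) (by positivity) (by positivity), ← Real.rpow_mul hl.le,
          mul_assoc α, hsp, mul_neg_one, Real.rpow_neg hl.le]
        congr 1
        have : 0 < l ^ α := by positivity
        field_simp

lemma euclNorm_eq_norm {N : ℕ} (x : Fin N → ℝ) : euclNorm x = ‖WithLp.toLp 2 x‖ := by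
  simp [euclNorm, EuclideanSpace.norm_eq]

lemma norm_le_euclNorm {N : ℕ} (x : Fin N → ℝ) : ‖x‖ ≤ euclNorm x := by
  rw [euclNorm_eq_norm, pi_norm_le_iff_of_nonneg (norm_nonneg _)]
  intro i
  exact PiLp.norm_apply_le (WithLp.toLp 2 x) i

lemma euclNorm_le {N : ℕ} (x : Fin N → ℝ) : euclNorm x ≤ N * ‖x‖ := by
  rw [euclNorm]
  refine Real.sqrt_le_iff.2 ⟨by positivity, ?_⟩
  calc ∑ i, x i ^ 2 ≤ ∑ _i : Fin N, ‖x‖ ^ 2 := by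
        refine Finset.sum_le_sum fun i _ => ?_
        rw [← sq_abs, ← Real.norm_eq_abs]
        gcongr
        exact norm_le_pi_norm x i
    _ = N * ‖x‖ ^ 2 := by simp
    _ ≤ (N * ‖x‖) ^ 2 := by
        rw [mul_pow]
        gcongr
        exact_mod_cast Nat.le_self_pow two_ne_zero N

lemma abs_euclNorm_sub_le {N : ℕ} (x y : Fin N → ℝ) :
    |euclNorm x - euclNorm y| ≤ N * ‖x - y‖ := by
  refine le_trans ?_ (euclNorm_le (x - y))
  simp only [euclNorm_eq_norm, WithLp.toLp_sub]
  exact abs_norm_sub_norm_le _ _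

/-- The logarithm of the correction factor between `t ^ α` and the weight. -/
noncomputable def logCorrection (α t : ℝ) : ℝ := (max 1 t - 1) - α * Real.log (max 1 t)

lemma abs_logCorrection_sub_le (α s t : ℝ) :
    |logCorrection α s - logCorrection α t| ≤ (1 + |α|) * |s - t| := by
  have h0 : |max 1 s - max 1 t| ≤ |s - t| := by
    simpa using abs_max_sub_max_le_max 1 s 1 t
  have hlog : ∀ u v : ℝ, 1 ≤ u → 1 ≤ v → Real.log u - Real.log v ≤ |u - v| := by
    intro u v hu hv
    rw [← Real.log_div (by positivity) (by positivity)]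
    have h1 := Real.log_le_sub_one_of_pos (x := u / v) (by positivity)
    have h2 : u / v - 1 = (u - v) / v := by field_simp
    have h3 : (u - v) / v ≤ |u - v| := by
      rw [div_le_iff₀ (by positivity)]
      nlinarith [le_abs_self (u - v), abs_nonneg (u - v)]
    linarith
  have h1 : |Real.log (max 1 s) - Real.log (max 1 t)| ≤ |s - t| := by
    refine le_trans (abs_sub_le_iff.2 ⟨hlog _ _ (le_max_left _ _) (le_max_left _ _), ?_⟩) h0
    rw [abs_sub_comm]
    exact hlog _ _ (le_max_left _ _) (le_max_left _ _)
  have h2 : logCorrection α s - logCorrection α t = (max 1 s - max 1 t) -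
      α * (Real.log (max 1 s) - Real.log (max 1 t)) := by
    unfold logCorrection; ring
  rw [h2]
  refine (abs_sub _ _).trans ?_
  rw [abs_mul]
  nlinarith [mul_le_mul_of_nonneg_left h1 (abs_nonneg α)]

lemma weight_eq (α t : ℝ) :
    (if t ≤ 1 then t ^ α else Real.exp (t - 1)) = t ^ α * Real.exp (logCorrection α t) := by
  unfold logCorrection
  split_ifs with h
  · simp [max_eq_left h]
  · have ht : 0 < t := by linarith
    rw [max_eq_right (by linarith), Real.rpow_def_of_pos ht, ← Real.exp_add]
    congr 1
    ring

lemma apLocConst_weight_lt_top {N : ℕ} (hN : 0 < N) {p α : ℝ} (hp : 1 < p)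
    (hα : -(N : ℝ) < α) (hα' : α < N * (p - 1)) :
    apLocConst N p
      (fun x => if euclNorm x ≤ 1 then euclNorm x ^ α else Real.exp (euclNorm x - 1)) < ⊤ := by
  obtain ⟨C, hC⟩ := exists_apFactor_norm_rpow_le hN hp hα hα'
  have hN1 : (1 : ℝ) ≤ N := by exact_mod_cast hN
  set K : ℝ := (1 + |α|) * N with hK
  set M : ℝ := (N : ℝ) ^ |α| with hM
  have hM0 : 0 < M := by positivity
  suffices h : ∀ (a : Fin N → ℝ) (l : ℝ), 0 < l → l ^ N ≤ 1 → apFactor N p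
      (fun x => if euclNorm x ≤ 1 then euclNorm x ^ α else Real.exp (euclNorm x - 1)) a l ≤
      ENNReal.ofReal (M * Real.exp K * (M * Real.exp K)) * ENNReal.ofReal C by
    exact lt_of_le_of_lt (iSup_le fun a => iSup_le fun l => iSup_le fun hl => iSup_le fun hl1 =>
      h a l hl hl1) (ENNReal.mul_lt_top ofReal_lt_top ofReal_lt_top)
  intro a l hl hlN
  have hl1 : l ≤ 1 := (pow_le_one_iff_of_nonneg hl.le hN.ne').1 hlN
  refine le_trans ?_ (mul_le_mul_right (hC a l hl) _)
  refine apFactor_le_of_comparable hp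
    (c := (M * Real.exp K)⁻¹ * Real.exp (logCorrection α (euclNorm a)))
    (by positivity) (by positivity) a ?_
  intro x hx
  have ha : a ∈ cube N a l := fun i _ => ⟨le_rfl, by linarith⟩
  have hosc : |logCorrection α (euclNorm x) - logCorrection α (euclNorm a)| ≤ K := by
    refine (abs_logCorrection_sub_le _ _ _).trans ?_
    rw [hK]
    have h1 := abs_euclNorm_sub_le x a
    have h2 := (norm_sub_lt_of_mem_cube hl hx ha).le.trans hl1
    have : |euclNorm x - euclNorm a| ≤ N := h1.trans (by nlinarith)
    gcongr
  rw [abs_le] at hosc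
  set e := Real.exp (logCorrection α (euclNorm x)) with he
  set e' := Real.exp (logCorrection α (euclNorm a)) with he'
  have hee : e ≤ Real.exp K * e' := by
    rw [he, he', ← Real.exp_add]; exact Real.exp_le_exp.2 (by linarith)
  have hee' : e' ≤ Real.exp K * e := by
    rw [he, he', ← Real.exp_add]; exact Real.exp_le_exp.2 (by linarith)
  have hpow : ‖x‖ ^ α ≤ M * euclNorm x ^ α ∧ euclNorm x ^ α ≤ M * ‖x‖ ^ α := by
    have h1 := norm_le_euclNorm x
    have h2 := euclNorm_le x
    rcases (norm_nonneg x).eq_or_lt with h | h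
    · rw [← h, mul_zero] at h2
      have : euclNorm x = 0 := le_antisymm h2 (Real.sqrt_nonneg _)
      rw [this, ← h]
      have : 1 ≤ M := Real.one_le_rpow hN1 (abs_nonneg α)
      have : 0 ≤ (0 : ℝ) ^ α := Real.rpow_nonneg le_rfl α
      constructor <;> nlinarith
    · have hE : 0 < euclNorm x := h.trans_le h1
      have h3 : ‖x‖ ≤ N * euclNorm x := by nlinarith
      exact ⟨rpow_le_of_comparable α h hE hN1 h3 h2, rpow_le_of_comparable α hE h hN1 h2 h3⟩
  have hEnn : 0 ≤ euclNorm x ^ α := Real.rpow_nonneg (Real.sqrt_nonneg _) α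
  simp only [weight_eq, ← he]
  constructor
  · rw [mul_assoc, inv_mul_le_iff₀ (by positivity)]
    calc e' * ‖x‖ ^ α ≤ (Real.exp K * e) * (M * euclNorm x ^ α) := by
          gcongr
          exact hpow.1
      _ = _ := by ring
  · rw [mul_assoc (M * Real.exp K), mul_inv_cancel_left₀ (by positivity)]
    calc euclNorm x ^ α * e ≤ (M * ‖x‖ ^ α) * (Real.exp K * e') := by
          gcongr
          exact hpow.2
      _ = _ := by ring

lemma apConst_eq_top {N : ℕ} (hN : 0 < N) {q : ℝ} (hq : 1 < q) (α : ℝ) :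
    apConst N q
      (fun x => if euclNorm x ≤ 1 then euclNorm x ^ α else Real.exp (euclNorm x - 1)) = ⊤ := by
  have : Nonempty (Fin N) := ⟨⟨0, hN⟩⟩
  have hq1 : 0 < q - 1 := by linarith
  set w : (Fin N → ℝ) → ℝ :=
    fun x => if euclNorm x ≤ 1 then euclNorm x ^ α else Real.exp (euclNorm x - 1) with hw
  set s : ℝ := 1 - q / (q - 1) with hs
  have hs' : s = -(1 / (q - 1)) := by rw [hs]; field_simp; ring
  have hs0 : s ≤ 0 := by rw [hs', neg_nonpos]; positivity
  set c : ℝ := Real.exp (3 * N) ^ s with hc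
  have hc0 : 0 < c := by positivity
  have hwt : ∀ x : Fin N → ℝ, 1 < ‖x‖ → w x = Real.exp (euclNorm x - 1) := fun x hx =>
    if_neg (not_le.2 (hx.trans_le (norm_le_euclNorm x)))
  have hcoord : ∀ x : Fin N → ℝ, ∀ t : ℝ, (∀ i, t ≤ x i) → t ≤ ‖x‖ := fun x t h =>
    (h ⟨0, hN⟩).trans ((le_abs_self _).trans (norm_le_pi_norm x ⟨0, hN⟩))
  have hlow : ∀ R : ℝ, 3 ≤ R →
      ENNReal.ofReal ((1 / 2) ^ N * Real.exp (R / 2 - 1) * (c / R ^ N) ^ (q - 1)) ≤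
        apFactor N q w 0 R := by
    intro R hR
    have hR0 : 0 < R := by linarith
    have hRN : 0 < R ^ N := by positivity
    have h1 : ENNReal.ofReal (Real.exp (R / 2 - 1) * (R / 2) ^ N) ≤
        ∫⁻ x in cube N 0 R, ENNReal.ofReal (w x) := by
      have hsub : cube N (fun _ => R / 2) (R / 2) ⊆ cube N 0 R := by
        intro x hx i _
        have := hx i (mem_univ i)
        simp only [mem_Ico, Pi.zero_apply] at this ⊢
        constructor <;> linarith
      refine le_trans ?_ (lintegral_mono_set hsub)
      rw [ENNReal.ofReal_mul (by positivity), ← volume_cube (fun _ => R / 2) (by positivity),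
        ← setLIntegral_const]
      refine setLIntegral_mono' (measurableSet_cube _ _) fun x hx => ?_
      have hx' : R / 2 ≤ ‖x‖ := hcoord x _ fun i => (hx i (mem_univ i)).1
      rw [hwt x (by linarith)]
      exact ENNReal.ofReal_le_ofReal (Real.exp_le_exp.2 (by linarith [norm_le_euclNorm x]))
    have h2 : ENNReal.ofReal c ≤ ∫⁻ x in cube N 0 R, ENNReal.ofReal (w x) ^ s := by
      have hsub : cube N (fun _ => 2) 1 ⊆ cube N 0 R := by
        intro x hx i _
        have := hx i (mem_univ i)
        simp only [mem_Ico, Pi.zero_apply] at this ⊢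
        constructor <;> linarith
      refine le_trans ?_ (lintegral_mono_set hsub)
      have hv : volume (cube N (fun _ => 2) 1) = 1 := by
        rw [volume_cube _ one_pos]; simp
      rw [← mul_one (ENNReal.ofReal c), ← hv, ← setLIntegral_const]
      refine setLIntegral_mono' (measurableSet_cube _ _) fun x hx => ?_
      have hx' : 2 ≤ ‖x‖ := hcoord x _ fun i => (hx i (mem_univ i)).1
      have hx3 : ‖x‖ ≤ 3 := by
        rw [pi_norm_le_iff_of_nonneg (by norm_num)]
        intro i
        have := hx i (mem_univ i)
        simp only [mem_Ico] at this
        rw [Real.norm_eq_abs, abs_le]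
        constructor <;> linarith
      rw [hwt x (by linarith), ENNReal.ofReal_rpow_of_pos (by positivity)]
      refine ENNReal.ofReal_le_ofReal (Real.rpow_le_rpow_of_nonpos (by positivity) ?_ hs0)
      refine Real.exp_le_exp.2 ?_
      have := euclNorm_le x
      have : (N : ℝ) * ‖x‖ ≤ N * 3 := by gcongr
      linarith
    unfold apFactor
    rw [ENNReal.ofReal_mul (by positivity), ← ENNReal.ofReal_rpow_of_pos (by positivity),
      ENNReal.ofReal_div_of_pos hRN,
      show (1 / 2 : ℝ) ^ N * Real.exp (R / 2 - 1) = Real.exp (R / 2 - 1) * (R / 2) ^ N / R ^ N by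
        rw [div_pow, div_pow, one_pow]; field_simp,
      ENNReal.ofReal_div_of_pos hRN]
    gcongr
  have hlim : Tendsto (fun R : ℝ => ENNReal.ofReal
      ((1 / 2) ^ N * Real.exp (R / 2 - 1) * (c / R ^ N) ^ (q - 1))) atTop (𝓝 ⊤) := by
    refine ENNReal.tendsto_ofReal_atTop.comp ?_
    have h := (tendsto_exp_mul_div_rpow_atTop (N * (q - 1)) (1 / 2) (by norm_num)).const_mul_atTop
      (show 0 < (1 / 2) ^ N * Real.exp (-1) * c ^ (q - 1) by positivity)
    refine h.congr' ?_
    filter_upwards [eventually_gt_atTop 0] with R hR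
    rw [Real.div_rpow hc0.le (by positivity), ← Real.rpow_natCast R N, ← Real.rpow_mul hR.le,
      show R / 2 - 1 = -1 + 1 / 2 * R by ring, Real.exp_add]
    ring
  rw [eq_top_iff]
  refine le_of_tendsto hlim ?_
  filter_upwards [eventually_ge_atTop 3] with R hR
  refine (hlow R hR).trans ?_
  exact le_iSup_of_le 0 (le_iSup_of_le R (le_iSup_of_le (by linarith) le_rfl))

/-- The weight `w(x) = |x|^α` for `|x| ≤ 1`, `w(x) = e^{|x|-1}` for `|x| > 1`, with
`-N < α < N(p-1)`, belongs to `A_p^loc` but not to `A_∞ = ∪_{q>1} A_q`. -/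
theorem local_weight_not_global (N : ℕ) (hN : 0 < N) (p α : ℝ) (hp : 1 < p)
    (hα : -(N : ℝ) < α) (hα' : α < N * (p - 1)) :
    apLocConst N p
        (fun x => if euclNorm x ≤ 1 then euclNorm x ^ α else Real.exp (euclNorm x - 1)) < ⊤ ∧
    ∀ q : ℝ, 1 < q →
      apConst N q
        (fun x => if euclNorm x ≤ 1 then euclNorm x ^ α else Real.exp (euclNorm x - 1)) = ⊤ := by
  exact ⟨apLocConst_weight_lt_top hN hp hα hα', fun q hq => apConst_eq_top hN hq α⟩
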